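/- (Theorem 1, precise form) Let Ω and Ω' be tensors in HOSVD form on local dimensions d(1),…,d(N). Then Ω and Ω' are LU equivalent if and only if G_n(Ω') = G_n(Ω) for every mode n and there exist unitary matrices S^(1), …, S^(N) with S^(n)·G_n(Ω) = G_n(Ω)·S^(n) for each n, such that Ω' = (S^(1) ⊗ ⋯ ⊗ S^(N))·Ω. In other words, two HOSVD core tensors represent the same entanglement class exactly when they are related by a local unitary symmetry that is block diagonal conformally with the multiplicities of the mode singular values. -/

import Mathlib

open Matrix

/-- An `N`-partite tensor on local dimensions `d 1, …, d N`. -/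
def Tensor {N : ℕ} (d : Fin N → ℕ) : Type := (∀ n, Fin (d n)) → ℂ

/-- Action of a family of local matrices on a tensor:
`(U·Ψ)(j) = Σ_k (Π_n U^(n)_{j_n k_n}) Ψ(k)`. -/
noncomputable def luAct {N : ℕ} {d : Fin N → ℕ}
    (U : ∀ n, Matrix (Fin (d n)) (Fin (d n)) ℂ) (Ψ : Tensor d) : Tensor d :=
  fun j => ∑ k : ∀ n, Fin (d n), (∏ n, U n (j n) (k n)) * Ψ k

/-- The mode-`n` Gram matrix of a tensor: its `(a,b)` entry is
`Σ Ψ(j[n↦a])·conj(Ψ(j[n↦b]))`, summed over the indices in the other modes. -/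
noncomputable def gram {N : ℕ} {d : Fin N → ℕ} (Ψ : Tensor d) (n : Fin N) :
    Matrix (Fin (d n)) (Fin (d n)) ℂ :=
  fun a b => ∑ j : ∀ m, Fin (d m),
    if j n = a then Ψ j * (starRingEnd ℂ) (Ψ (Function.update j n b)) else 0

/-- A tensor is in HOSVD (core) form if each mode-`n` Gram matrix is diagonal
with real, nonnegative, non-increasing diagonal entries. -/
def IsHOSVD {N : ℕ} {d : Fin N → ℕ} (Ω : Tensor d) : Prop :=
  ∀ n : Fin N,
    (gram Ω n).IsDiag ∧
    (∀ a, (gram Ω n a a).im = 0 ∧ 0 ≤ (gram Ω n a a).re) ∧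
    (∀ a b : Fin (d n), a ≤ b → (gram Ω n b b).re ≤ (gram Ω n a a).re)

/-- LU equivalence of tensors. -/
def LUEquiv {N : ℕ} {d : Fin N → ℕ} (Ψ Ψ' : Tensor d) : Prop :=
  ∃ U : ∀ n, Matrix (Fin (d n)) (Fin (d n)) ℂ,
    (∀ n, U n ∈ Matrix.unitaryGroup (Fin (d n)) ℂ) ∧ Ψ' = luAct U Ψ

/-- The sesquilinear form on tensors given by a product kernel `F`, on the diagonal. -/
noncomputable def kernelForm {N : ℕ} {d : Fin N → ℕ}
    (F : ∀ n, Matrix (Fin (d n)) (Fin (d n)) ℂ) (Ψ : Tensor d) : ℂ :=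
  ∑ j : ∀ n, Fin (d n), ∑ k : ∀ n, Fin (d n),
    (∏ n, F n (j n) (k n)) * (Ψ j * (starRingEnd ℂ) (Ψ k))

/-- A product kernel that is trivial away from the mode `n` sums over that mode only. -/
theorem sum_prod_update_one {N : ℕ} {d : Fin N → ℕ} (n : Fin N)
    (M : Matrix (Fin (d n)) (Fin (d n)) ℂ) (j : ∀ m, Fin (d m))
    (g : (∀ m, Fin (d m)) → ℂ) :
    ∑ k, (∏ m, Function.update (fun m => (1 : Matrix (Fin (d m)) (Fin (d m)) ℂ)) n M m
      (j m) (k m)) * g k = ∑ b, M (j n) b * g (Function.update j n b) := by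
  symm
  refine Finset.sum_of_injOn (fun b => Function.update j n b)
    (Function.update_injective j n).injOn (fun _ _ => Finset.mem_coe.2 (Finset.mem_univ _)) ?_ ?_
  · intro k _ hk
    obtain ⟨m, hmn, hm⟩ : ∃ m, m ≠ n ∧ j m ≠ k m := by
      by_contra! h
      refine hk ⟨k n, by simp, ?_⟩
      funext m
      by_cases hm : m = n
      · subst hm; simp
      · simp [hm, h m hm]
    rw [Finset.prod_eq_zero (Finset.mem_univ m), zero_mul]
    rw [Function.update_of_ne hmn, Matrix.one_apply_ne hm]
  · intro b _
    congr 1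
    rw [Finset.prod_eq_single n]
    · simp
    · intro m _ hm
      simp [Function.update_of_ne hm]
    · simp

theorem kernelForm_update_one {N : ℕ} {d : Fin N → ℕ} (Ψ : Tensor d) (n : Fin N)
    (M : Matrix (Fin (d n)) (Fin (d n)) ℂ) :
    kernelForm (Function.update (fun _ => 1) n M) Ψ = ∑ a, ∑ b, M a b * gram Ψ n a b := by
  simp only [kernelForm, _root_.gram, Finset.mul_sum]
  conv_rhs => rw [Finset.sum_congr rfl fun a _ => Finset.sum_comm, Finset.sum_comm]
  refine Finset.sum_congr rfl fun j _ => ?_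
  rw [sum_prod_update_one n M j fun k => Ψ j * (starRingEnd ℂ) (Ψ k)]
  symm
  rw [Finset.sum_eq_single (j n)]
  · simp
  · intro a _ ha
    simp [Ne.symm ha]
  · simp

theorem kernelForm_luAct {N : ℕ} {d : Fin N → ℕ}
    (F U : ∀ n, Matrix (Fin (d n)) (Fin (d n)) ℂ) (Ψ : Tensor d) :
    kernelForm F (luAct U Ψ) =
      kernelForm (fun n => (U n)ᵀ * F n * (U n).map (starRingEnd ℂ)) Ψ := by
  have key : ∀ k l : ∀ n, Fin (d n),
      ∏ n, ((U n)ᵀ * F n * (U n).map (starRingEnd ℂ)) (k n) (l n) =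
        ∑ i : ∀ n, Fin (d n), ∑ j : ∀ n, Fin (d n), (∏ n, F n (i n) (j n)) *
          ((∏ n, U n (i n) (k n)) * ∏ n, (starRingEnd ℂ) (U n (j n) (l n))) := by
    intro k l
    simp only [Matrix.mul_assoc]
    simp only [Matrix.mul_apply, Matrix.transpose_apply, Matrix.map_apply, Finset.mul_sum]
    rw [Finset.prod_univ_sum, Fintype.piFinset_univ]
    refine Finset.sum_congr rfl fun i _ => ?_
    rw [Finset.prod_univ_sum, Fintype.piFinset_univ]
    refine Finset.sum_congr rfl fun j _ => ?_
    rw [← Finset.prod_mul_distrib, ← Finset.prod_mul_distrib]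
    exact Finset.prod_congr rfl fun n _ => by ring
  have swap : ∀ f : (∀ n, Fin (d n)) → (∀ n, Fin (d n)) → (∀ n, Fin (d n)) →
      (∀ n, Fin (d n)) → ℂ, ∑ i, ∑ j, ∑ k, ∑ l, f i j k l = ∑ k, ∑ l, ∑ i, ∑ j, f i j k l := by
    intro f
    have h := Finset.sum_comm (s := Finset.univ) (t := Finset.univ)
      (f := fun x y : (∀ n, Fin (d n)) × (∀ n, Fin (d n)) => f x.1 x.2 y.1 y.2)
    simpa only [Fintype.sum_prod_type] using h
  simp only [kernelForm, key, luAct, map_sum, map_mul, map_prod, Finset.sum_mul,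
    Finset.mul_sum]
  rw [swap, Finset.sum_comm]
  refine Finset.sum_congr rfl fun k _ => Finset.sum_congr rfl fun l _ =>
    Finset.sum_congr rfl fun i _ => Finset.sum_congr rfl fun j _ => ?_
  ring

theorem gram_luAct {N : ℕ} {d : Fin N → ℕ}
    {U : ∀ n, Matrix (Fin (d n)) (Fin (d n)) ℂ}
    (hU : ∀ n, U n ∈ Matrix.unitaryGroup (Fin (d n)) ℂ) (Ψ : Tensor d) (n : Fin N) :
    gram (luAct U Ψ) n = U n * gram Ψ n * (U n)ᴴ := by
  ext a b
  have h := kernelForm_luAct (Function.update (fun _ => 1) n (Matrix.single a b 1)) U Ψ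
  have hF : (fun m => (U m)ᵀ * (Function.update (fun _ => 1) n (Matrix.single a b 1) :
        ∀ m, Matrix (Fin (d m)) (Fin (d m)) ℂ) m * (U m).map (starRingEnd ℂ)) =
      Function.update (fun _ => 1) n
        ((U n)ᵀ * Matrix.single a b 1 * (U n).map (starRingEnd ℂ)) := by
    funext m
    by_cases hm : m = n
    · subst hm; simp
    · rw [Function.update_of_ne hm, Function.update_of_ne hm, mul_one]
      have := congrArg Matrix.transpose (Matrix.mem_unitaryGroup_iff'.1 (hU m))
      rwa [Matrix.transpose_mul, Matrix.transpose_one] at this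
  rw [hF, kernelForm_update_one, kernelForm_update_one] at h
  have hl : ∑ x, ∑ y, Matrix.single a b (1 : ℂ) x y * gram (luAct U Ψ) n x y =
      gram (luAct U Ψ) n a b := by
    rw [Finset.sum_eq_single a, Finset.sum_eq_single b]
    · simp
    · intro y _ hy
      simp [Ne.symm hy]
    · simp
    · intro x _ hx
      simp [Ne.symm hx]
    · simp
  rw [← hl, h, Finset.sum_comm]
  simp only [Matrix.mul_apply, Finset.sum_mul, Matrix.conjTranspose_apply]
  refine Finset.sum_congr rfl fun y _ => Finset.sum_congr rfl fun x _ => ?_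
  rw [Finset.sum_eq_single b, Finset.sum_eq_single a]
  · simp; ring
  · intro i _ hi
    simp [Ne.symm hi]
  · simp
  · intro i _ hi
    simp [Ne.symm hi]
  · simp

/-- Antitone tuples with the same multiset of values are equal. -/
theorem Antitone.eq_of_univ_val_map_eq {α : Type*} [PartialOrder α] {n : ℕ} {f g : Fin n → α}
    (hf : Antitone f) (hg : Antitone g)
    (h : Finset.univ.val.map f = Finset.univ.val.map g) : f = g := by
  rw [Fin.univ_val_map, Fin.univ_val_map, Multiset.coe_eq_coe] at h
  exact List.ofFn_injective (h.eq_of_pairwise' hf.sortedGE_ofFn.pairwise hg.sortedGE_ofFn.pairwise)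

/-- Unitarily similar matrices that are both diagonal with real non-increasing entries are
equal. -/
theorem diagonal_eq_of_unitary_conj {n : ℕ} {A B U : Matrix (Fin n) (Fin n) ℂ}
    (hU : U ∈ Matrix.unitaryGroup (Fin n) ℂ) (h : B = U * A * Uᴴ)
    (hA : A.IsDiag) (hB : B.IsDiag) (hAr : ∀ a, (A a a).im = 0) (hBr : ∀ a, (B a a).im = 0)
    (hAm : Antitone fun a => (A a a).re) (hBm : Antitone fun a => (B a a).re) : B = A := by
  have hc : B.charpoly = A.charpoly := by
    rw [h, mul_assoc, Matrix.charpoly_mul_comm, mul_assoc,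
      show Uᴴ * U = 1 from Matrix.mem_unitaryGroup_iff'.1 hU, mul_one]
  have hm : Finset.univ.val.map B.diag = Finset.univ.val.map A.diag := by
    rw [← hA.diagonal_diag, ← hB.diagonal_diag, Matrix.charpoly_diagonal,
      Matrix.charpoly_diagonal] at hc
    have hr : ∀ v : Fin n → ℂ, (∏ i, (Polynomial.X - Polynomial.C (v i))).roots =
        Finset.univ.val.map v := fun v => by
      rw [← Polynomial.roots_multiset_prod_X_sub_C (Finset.univ.val.map v), Multiset.map_map]
      rfl
    rw [← hr, ← hr, hc]
  have hre : (fun a => (B a a).re) = fun a => (A a a).re := by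
    refine Antitone.eq_of_univ_val_map_eq hBm hAm ?_
    have := congrArg (Multiset.map Complex.re) hm
    rwa [Multiset.map_map, Multiset.map_map] at this
  rw [← hA.diagonal_diag, ← hB.diagonal_diag]
  congr 1
  funext a
  exact Complex.ext (congrFun hre a) ((hBr a).trans (hAr a).symm)

/-- Theorem 1 (precise form): two HOSVD core tensors are LU equivalent iff
their mode Gram matrices coincide and they are related by a local unitary
symmetry whose factors commute with the corresponding Gram matrices (i.e. are
block diagonal conformally with the singular value multiplicities). -/
theorem hosvd_LU_iff_block_symmetry {N : ℕ} {d : Fin N → ℕ} (Ω Ω' : Tensor d)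
    (hΩ : IsHOSVD Ω) (hΩ' : IsHOSVD Ω') :
    LUEquiv Ω Ω' ↔
      ((∀ n, gram Ω' n = gram Ω n) ∧
        ∃ S : ∀ n, Matrix (Fin (d n)) (Fin (d n)) ℂ,
          (∀ n, S n ∈ Matrix.unitaryGroup (Fin (d n)) ℂ ∧
            S n * gram Ω n = gram Ω n * S n) ∧
          Ω' = luAct S Ω) := by
  constructor
  · rintro ⟨U, hU, rfl⟩
    have hG : ∀ n, gram (luAct U Ω) n = gram Ω n := fun n =>
      diagonal_eq_of_unitary_conj (hU n) (gram_luAct hU Ω n) (hΩ n).1 (hΩ' n).1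
        (fun a => ((hΩ n).2.1 a).1) (fun a => ((hΩ' n).2.1 a).1) (hΩ n).2.2 (hΩ' n).2.2
    refine ⟨hG, U, fun n => ⟨hU n, ?_⟩, rfl⟩
    conv_rhs => rw [← hG n, gram_luAct hU, mul_assoc,
      show (U n)ᴴ * U n = 1 from Matrix.mem_unitaryGroup_iff'.1 (hU n), mul_one]
  · rintro ⟨-, S, hS, h⟩
    exact ⟨S, fun n => (hS n).1, h⟩
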